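/- arXiv:1808.04282 — 2 statements merged into one kernel-verified Lean document; each statement's English description precedes it below -/
import Mathlib

section
/- Let N̄(m,n) denote the number of overpartitions of n with D-rank m. Then for all integers m ≥ 0 and n ≥ 0, N̄(m,n) ≥ N̄(m+2,n). -/
/-- An overpartition of `n` is a partition of `n` together with a set of part sizes
whose first occurrence is overlined; we model it as a pair `(λ, S)` with
`λ : Nat.Partition n` and `S` a subset of the set of part sizes of `λ`.
`overN m n` is the number of overpartitions of `n` whose D-rank
(largest part minus number of parts) equals `m`. -/
noncomputable def overN (m : ℤ) (n : ℕ) : ℕ :=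
  Set.ncard {p : n.Partition × Finset ℕ |
    p.2 ⊆ p.1.parts.toFinset ∧ (p.1.parts.sup : ℤ) - Multiset.card p.1.parts = m}

/-! Durfee-square encoding of partitions by lists of pairs. -/

namespace OverN

/-- The parts to the right of the Durfee square. -/
def T : List (ℕ × ℕ) → Multiset ℕ
  | [] => 0
  | p :: l => p.1 ::ₘ (T l).map (· + p.1)

/-- The parts below the Durfee square. -/
def B : List (ℕ × ℕ) → Multiset ℕ
  | [] => 0
  | p :: l => Multiset.replicate p.2 (l.length + 1) + B l

/-- The partition encoded by a list. -/
def Lam (l : List (ℕ × ℕ)) : Multiset ℕ := (T l).map (· + l.length) + B l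

/-- The rank statistic. -/
def rk : List (ℕ × ℕ) → ℤ
  | [] => 0
  | p :: l => rk l + p.1 - p.2

/-- Local weight. -/
def w (p : ℕ × ℕ) : ℕ := (if p.1 = 0 then 1 else 2) * (if p.2 = 0 then 1 else 2)

/-- Product of local weights. -/
def W : List (ℕ × ℕ) → ℕ
  | [] => 1
  | p :: l => w p * W l

/-- Local weight at the corner. -/
def wCorner (p : ℕ × ℕ) : ℕ := if p = (0, 0) then 2 else w p

/-- Total weight. -/
def WTot : List (ℕ × ℕ) → ℕ
  | [] => 1
  | p :: l => wCorner p * W l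

/-- Size of the part outside the Durfee square. -/
def sz : List ℕ → ℕ
  | [] => 0
  | s :: t => s * (t.length + 1) + sz t

/-- The map to level sums. -/
def sg (l : List (ℕ × ℕ)) : List ℕ := l.map (fun p => p.1 + p.2)

/-- All lists with given level sums. -/
def LL : List ℕ → Finset (List (ℕ × ℕ))
  | [] => {[]}
  | s :: t => (Finset.HasAntidiagonal.antidiagonal s ×ˢ LL t).image (fun x => x.1 :: x.2)

lemma mem_LL (s : List ℕ) (l : List (ℕ × ℕ)) : l ∈ LL s ↔ sg l = s := by
  induction s generalizing l with
  | nil => simp [LL, sg]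
  | cons s t ih =>
    cases l with
    | nil => simp [LL, sg]
    | cons p l =>
      have := ih l
      simp only [sg] at this
      simp [LL, sg, this]

lemma card_T (l) : Multiset.card (T l) = l.length := by
  induction l with
  | nil => simp [T]
  | cons p l ih => simp [T, ih]

lemma mem_B (l) (x) (hx : x ∈ B l) : 1 ≤ x ∧ x ≤ l.length := by
  induction l with
  | nil => simp [B] at hx
  | cons p l ih =>
    simp only [B, Multiset.mem_add] at hx
    rcases hx with hx | hx
    · have := Multiset.eq_of_mem_replicate hx
      simp [this]
    · have := ih hx
      simp; omega

lemma sum_TB (l) : (T l).sum + (B l).sum = sz (sg l) := by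
  induction l with
  | nil => simp [T, B, sz, sg]
  | cons p l ih =>
    simp only [sg] at ih
    simp [T, B, sz, sg, Multiset.sum_map_add, card_T, ← ih]
    ring

lemma sum_Lam (l) : (Lam l).sum = l.length * l.length + sz (sg l) := by
  rw [← sum_TB]
  simp [Lam, Multiset.sum_map_add, card_T]
  ring

lemma sup_shift (M : Multiset ℕ) (a : ℕ) : (a ::ₘ M.map (· + a)).sup = M.sup + a := by
  induction M using Multiset.induction_on with
  | empty => simp
  | cons x M ih =>
    simp at ih ⊢
    omega

lemma rk_eq (l) : ((T l).sup : ℤ) - Multiset.card (B l) = rk l := by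
  induction l with
  | nil => simp [T, B, rk]
  | cons p l ih =>
    simp only [T, B, rk, sup_shift, ← ih]
    simp
    ring

lemma rk_Lam (l) : ((Lam l).sup : ℤ) - Multiset.card (Lam l) = rk l := by
  rw [← rk_eq]
  have h : (Lam l).sup = (T l).sup + l.length := by
    cases l with
    | nil => simp [Lam, T, B]
    | cons p l =>
      have h1 : (B (p :: l)).sup ≤ (p :: l).length := Multiset.sup_le.2 fun x hx => (mem_B _ x hx).2
      rw [← sup_shift]
      have h2 : ((T (p :: l)).map (· + (p :: l).length)).sup
          ≥ (p :: l).length := by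
        refine le_trans ?_ (Multiset.le_sup (Multiset.mem_map_of_mem _ (?_ : p.1 ∈ T (p :: l))))
        · simp
        · simp [T]
      simp only [Lam, Multiset.sup_add, Multiset.sup_cons]
      have e : ∀ a b : ℕ, a ⊔ b = max a b := fun _ _ => rfl
      rw [e, e]
      omega
  rw [h]
  simp [Lam, card_T]
  ring

lemma card_T_erase (l) :
    2 ^ ((T l).toFinset.erase 0).card * 2 ^ (B l).toFinset.card = W l := by
  induction l with
  | nil => simp [T, B, W]
  | cons p l ih =>
    obtain ⟨a, b⟩ := p
    have h1 : 2 ^ ((T ((a, b) :: l)).toFinset.erase 0).card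
        = (if a = 0 then 1 else 2) * 2 ^ ((T l).toFinset.erase 0).card := by
      split_ifs with h
      · subst h
        have : (T ((0, b) :: l)).toFinset.erase 0 = (T l).toFinset.erase 0 := by
          ext x; simp [T]
        rw [this]; simp
      · have : (T ((a, b) :: l)).toFinset.erase 0
            = insert a (((T l).toFinset.erase 0).image (· + a)) := by
          ext x
          simp [T]
          constructor
          · rintro ⟨h0, rfl | ⟨y, hy, rfl⟩⟩
            · simp
            · by_cases h : y = 0
              · left; omega
              · right; exact ⟨y, ⟨h, hy⟩, rfl⟩
          · rintro (rfl | ⟨y, ⟨h, hy⟩, rfl⟩)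
            · exact ⟨h, Or.inl rfl⟩
            · exact ⟨by omega, Or.inr ⟨y, hy, rfl⟩⟩
        rw [this, Finset.card_insert_of_notMem, Finset.card_image_of_injective, pow_succ, mul_comm]
        · exact add_left_injective a
        · simp; 
    have h2 : 2 ^ (B ((a, b) :: l)).toFinset.card
        = (if b = 0 then 1 else 2) * 2 ^ (B l).toFinset.card := by
      split_ifs with h
      · subst h; simp [B]
      · have : (B ((a, b) :: l)).toFinset = insert (l.length + 1) (B l).toFinset := by
          ext x; simp [B, Multiset.mem_replicate, h]
        rw [this, Finset.card_insert_of_notMem, pow_succ, mul_comm]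
        intro hx
        have := mem_B l _ (Multiset.mem_toFinset.1 hx)
        omega
    rw [h1, h2, W, ← ih, w]
    ring

lemma card_Lam (l) : 2 ^ (Lam l).toFinset.card = WTot l := by
  cases l with
  | nil => simp [Lam, T, B, WTot]
  | cons p l =>
    obtain ⟨a, b⟩ := p
    have key := card_T_erase ((a, b) :: l)
    set d := ((a, b) :: l).length with hd
    have hdis : Disjoint (((T ((a, b) :: l)).toFinset.erase 0).image (· + d))
        (B ((a, b) :: l)).toFinset := by
      rw [Finset.disjoint_left]
      intro x hx hx'
      have := mem_B _ _ (Multiset.mem_toFinset.1 hx')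
      simp only [Finset.mem_image, Finset.mem_erase] at hx
      obtain ⟨y, ⟨h, -⟩, rfl⟩ := hx
      omega
    have hc : ((((T ((a, b) :: l)).toFinset.erase 0).image (· + d)) ∪
        (B ((a, b) :: l)).toFinset).card =
        ((T ((a, b) :: l)).toFinset.erase 0).card + (B ((a, b) :: l)).toFinset.card := by
      rw [Finset.card_union_of_disjoint hdis,
        Finset.card_image_of_injective _ (add_left_injective d)]
    have h0 : 0 ∈ T ((a, b) :: l) → a = 0 := by
      simp [T]; intro h; rcases h with h | h
      · omega
      · exact h.2
    by_cases h : a = 0 ∧ b = 0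
    · obtain ⟨rfl, rfl⟩ := h
      have e : (Lam ((0, 0) :: l)).toFinset = insert d
          ((((T ((0, 0) :: l)).toFinset.erase 0).image (· + d)) ∪ (B ((0, 0) :: l)).toFinset) := by
        ext x
        simp only [Lam, Multiset.toFinset_add, Finset.mem_union, Multiset.mem_toFinset,
          Multiset.mem_map, Finset.mem_insert, Finset.mem_image, Finset.mem_erase, ← hd]
        constructor
        · rintro (⟨y, hy, rfl⟩ | hx)
          · by_cases h : y = 0
            · left; omega
            · right; left; exact ⟨y, ⟨h, hy⟩, rfl⟩
          · exact Or.inr (Or.inr hx)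
        · rintro (rfl | ⟨y, ⟨h, hy⟩, rfl⟩ | hx)
          · left; exact ⟨0, by simp [T], by simp⟩
          · left; exact ⟨y, hy, rfl⟩
          · right; exact hx
      rw [e, Finset.card_insert_of_notMem, hc, pow_succ, pow_add, key]
      · simp [W, WTot, w, wCorner, mul_comm]
      · simp only [Finset.mem_union, Finset.mem_image, Finset.mem_erase, Multiset.mem_toFinset]
        rintro (⟨y, ⟨h, hy⟩, h'⟩ | hx)
        · omega
        · simp only [B, Multiset.replicate_zero, zero_add] at hx
          have := mem_B _ _ hx
          simp at hd
          omega
    · have e : (Lam ((a, b) :: l)).toFinset =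
          ((((T ((a, b) :: l)).toFinset.erase 0).image (· + d)) ∪ (B ((a, b) :: l)).toFinset) := by
        ext x
        simp only [Lam, Multiset.toFinset_add, Finset.mem_union, Multiset.mem_toFinset,
          Multiset.mem_map, Finset.mem_image, Finset.mem_erase, ← hd]
        constructor
        · rintro (⟨y, hy, rfl⟩ | hx)
          · by_cases h' : y = 0
            · subst h'
              right
              have ha := h0 hy
              have hb : b ≠ 0 := fun hb => h ⟨ha, hb⟩
              simp [B, Multiset.mem_replicate, hb, hd]
            · left; exact ⟨y, ⟨h', hy⟩, rfl⟩
          · exact Or.inr hx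
        · rintro (⟨y, ⟨h, hy⟩, rfl⟩ | hx)
          · left; exact ⟨y, hy, rfl⟩
          · right; exact hx
      rw [e, hc, pow_add, key]
      simp [W, WTot, wCorner, h]

lemma TB_inj (l l' : List (ℕ × ℕ)) (hl : l.length = l'.length) (hT : T l = T l')
    (hB : B l = B l') : l = l' := by
  induction l generalizing l' with
  | nil => simp at hl; exact (List.length_eq_zero_iff.1 hl.symm).symm
  | cons p l ih =>
    cases l' with
    | nil => simp at hl
    | cons p' l' =>
      obtain ⟨a, b⟩ := p
      obtain ⟨a', b'⟩ := p'
      simp only [List.length_cons, add_left_inj] at hl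
      have ha : a = a' := by
        simp only [T] at hT
        have h1 : a ∈ a' ::ₘ (T l').map (· + a') := by rw [← hT]; simp
        have h2 : a' ∈ a ::ₘ (T l).map (· + a) := by rw [hT]; simp
        simp at h1 h2
        have h3 : a' ≤ a := by
          rcases h1 with h | ⟨y, -, h⟩ <;> omega
        have h4 : a ≤ a' := by
          rcases h2 with h | ⟨y, -, h⟩ <;> omega
        omega
      subst ha
      have hb : b = b' := by
        have := congrArg (Multiset.count (l.length + 1)) hB
        have n1 : (B l).count (l.length + 1) = 0 := Multiset.count_eq_zero.2 fun h => by
          have := mem_B _ _ h; omega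
        have n2 : (B l').count (l.length + 1) = 0 := Multiset.count_eq_zero.2 fun h => by
          have := mem_B _ _ h; omega
        simpa [B, n1, n2, ← hl, Multiset.count_replicate] using this
      subst hb
      have hT' : T l = T l' := by
        simp only [T, Multiset.cons_inj_right] at hT
        exact Multiset.map_injective (add_left_injective a) hT
      have hB' : B l = B l' := by
        simpa [B, hl] using hB
      rw [ih l' hl hT' hB']

lemma Lam_gt (l) (x : ℕ) : (Lam l).count (x + 1 + l.length) = (T l).count (x + 1) := by
  have n1 : (B l).count (x + 1 + l.length) = 0 := Multiset.count_eq_zero.2 fun h => by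
    have := mem_B _ _ h; omega
  rw [Lam, Multiset.count_add, n1, add_zero]
  exact Multiset.count_map_eq_count' (· + l.length) _ (add_left_injective _) (x + 1)

lemma Lam_len_le (l l' : List (ℕ × ℕ)) (h : Lam l = Lam l') : l.length ≤ l'.length := by
  by_contra hlt
  push Not at hlt
  have h1 : l.length ≤ ((Lam l).filter (fun x => l'.length < x)).card := by
    rw [Lam, Multiset.filter_add, Multiset.card_add]
    rw [Multiset.filter_eq_self.2]
    · simp [card_T]
    · intro x hx
      obtain ⟨y, -, rfl⟩ := Multiset.mem_map.1 hx
      omega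
  have h2 : ((Lam l').filter (fun x => l'.length < x)).card ≤ l'.length := by
    rw [Lam, Multiset.filter_add, Multiset.card_add]
    rw [Multiset.filter_eq_nil (s := B l') |>.2]
    · refine le_trans (Nat.add_le_add_right (Multiset.card_le_card (Multiset.filter_le _ _)) _) ?_
      simp [card_T]
    · intro x hx
      have := mem_B _ _ hx
      omega
  rw [h] at h1
  omega

lemma card_eq_count_zero (M : Multiset ℕ) :
    M.card = M.count 0 + (M.filter (fun x => x ≠ 0)).card := by
  have := congrArg Multiset.card (Multiset.filter_add_not (fun x => 0 = x) M)
  rw [Multiset.card_add] at this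
  rw [← this, Multiset.count_eq_card_filter_eq]
  simp [eq_comm]

lemma Lam_inj : Function.Injective Lam := by
  intro l l' h
  have hl : l.length = l'.length := le_antisymm (Lam_len_le _ _ h) (Lam_len_le _ _ h.symm)
  have hpos : ∀ x, (T l).count (x + 1) = (T l').count (x + 1) := by
    intro x
    rw [← Lam_gt, ← Lam_gt, h, hl]
  have hf : (T l).filter (fun x => x ≠ 0) = (T l').filter (fun x => x ≠ 0) := by
    ext x
    rw [Multiset.count_filter, Multiset.count_filter]
    cases x with
    | zero => simp
    | succ x => simp [hpos]
  have hT : T l = T l' := by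
    ext x
    cases x with
    | zero =>
      have h1 := card_eq_count_zero (T l)
      have h2 := card_eq_count_zero (T l')
      rw [card_T] at h1 h2
      rw [hf] at h1
      omega
    | succ x => exact hpos x
  refine TB_inj l l' hl hT ?_
  rw [Lam, Lam, hT, hl] at h
  exact add_left_cancel h

lemma TB_surj (d : ℕ) (t b : Multiset ℕ) (ht : t.card = d) (hb : ∀ x ∈ b, 1 ≤ x ∧ x ≤ d) :
    ∃ l : List (ℕ × ℕ), l.length = d ∧ T l = t ∧ B l = b := by
  induction d generalizing t b with
  | zero =>
    refine ⟨[], rfl, ?_, ?_⟩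
    · rw [Multiset.card_eq_zero] at ht; simp [T, ht]
    · symm; simp only [B]; rw [Multiset.eq_zero_iff_forall_notMem]
      intro x hx; have := hb x hx; omega
  | succ d ih =>
    have hne : ∃ a, a ∈ t := Multiset.card_pos_iff_exists_mem.1 (by omega)
    have hmin : ∃ a ∈ t, ∀ y ∈ t, a ≤ y := by
      classical
      exact ⟨Nat.find hne, Nat.find_spec hne, fun y hy => Nat.find_min' hne hy⟩
    obtain ⟨a, hat, ha⟩ := hmin
    obtain ⟨t0, rfl⟩ := Multiset.exists_cons_of_mem hat
    obtain ⟨l, hl, hlT, hlB⟩ := ih (t0.map (· - a)) (b.filter (fun x => ¬ (d + 1 = x)))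
      (by simpa using ht) (by
        intro x hx
        rw [Multiset.mem_filter] at hx
        have := hb x hx.1
        omega)
    refine ⟨(a, b.count (d + 1)) :: l, by simp [hl], ?_, ?_⟩
    · simp only [T, hlT, Multiset.map_map]
      congr 1
      conv_rhs => rw [← Multiset.map_id t0]
      apply Multiset.map_congr rfl
      intro x hx
      have := ha x (Multiset.mem_cons_of_mem hx)
      simp; omega
    · simp only [B, hlB, hl]
      rw [← Multiset.filter_eq]
      exact Multiset.filter_add_not _ _

lemma Lam_surj (M : Multiset ℕ) (hM : ∀ x ∈ M, 0 < x) : ∃ l, Lam l = M := by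
  classical
  have hex : ∃ d, (M.filter (fun x => d < x)).card ≤ d :=
    ⟨M.card, Multiset.card_le_card (Multiset.filter_le _ _)⟩
  obtain ⟨d, hd, hmin⟩ : ∃ d, (M.filter (fun x => d < x)).card ≤ d ∧
      ∀ e < d, ¬ (M.filter (fun x => e < x)).card ≤ e :=
    ⟨Nat.find hex, Nat.find_spec hex, fun e he => Nat.find_min hex he⟩
  have hsplit := Multiset.filter_add_not (fun x => d < x) M
  set P := M.filter (fun x => d < x) with hP
  set Q := M.filter (fun x => ¬ d < x) with hQ
  have hcnt : d - P.card ≤ Q.count d := by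
    rcases Nat.eq_zero_or_pos d with h0 | h0
    · omega
    · have h1 := hmin (d - 1) (by omega)
      have h2 : (M.filter (fun x => d - 1 < x)).card = P.card + Q.count d := by
        rw [← hsplit, Multiset.filter_add, Multiset.card_add]
        congr 1
        · rw [Multiset.filter_eq_self.2]
          intro x hx
          have := (Multiset.mem_filter.1 hx).2
          omega
        · rw [Multiset.count_eq_card_filter_eq]
          congr 1
          apply Multiset.filter_congr
          intro x hx
          have := (Multiset.mem_filter.1 hx).2
          omega
      omega
  have hle : Multiset.replicate (d - P.card) d ≤ Q := Multiset.le_count_iff_replicate_le.1 hcnt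
  obtain ⟨R, hR⟩ := Multiset.le_iff_exists_add.1 hle
  obtain ⟨l, hl, hT, hB⟩ := TB_surj d (P.map (· - d) + Multiset.replicate (d - P.card) 0) R
    (by simp; omega) (by
      intro x hx
      have hxQ : x ∈ Q := by rw [hR]; exact Multiset.mem_add.2 (Or.inr hx)
      have := Multiset.mem_filter.1 hxQ
      have := hM x this.1
      omega)
  refine ⟨l, ?_⟩
  have hPP : (P.map (· - d)).map (· + d) = P := by
    rw [Multiset.map_map]
    conv_rhs => rw [← Multiset.map_id P]
    apply Multiset.map_congr rfl
    intro x hx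
    have := (Multiset.mem_filter.1 hx).2
    simp; omega
  rw [Lam, hT, hB, hl, Multiset.map_add, hPP, ← hsplit, hR, add_assoc]
  simp

/-- Symmetric and unimodal along each parity class. -/
def Good (f : ℤ → ℕ) : Prop := (∀ m, f (-m) = f m) ∧ ∀ m, 0 ≤ m → f (m + 2) ≤ f m

lemma Good.le {f : ℤ → ℕ} (hf : Good f) (m : ℤ) (hm : 0 ≤ m) (k : ℕ) : f (m + 2 * k) ≤ f m := by
  induction k with
  | zero => simp
  | succ k ih =>
    refine le_trans ?_ ih
    have h := hf.2 (m + 2 * k) (by omega)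
    have e : m + 2 * ((k + 1 : ℕ) : ℤ) = m + 2 * k + 2 := by push_cast; ring
    rw [e]
    exact h

lemma Good.le' {f : ℤ → ℕ} (hf : Good f) (m : ℤ) (s : ℕ) (hm : 0 ≤ m) :
    f (m + s + 2) ≤ f (m - s) := by
  rcases le_total 0 (m - s) with h | h
  · have := hf.le (m - s) h (s + 1)
    convert this using 2
    push_cast; ring
  · rw [← hf.1 (m - s)]
    have := hf.le (-(m - s)) (by omega) (m.toNat + 1)
    convert this using 2
    push_cast
    rw [Int.toNat_of_nonneg hm]; ring

lemma chi_tel (f : ℤ → ℕ) (s : ℕ) (m : ℤ) :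
    (∑ p ∈ Finset.HasAntidiagonal.antidiagonal s, f (m + 2 - p.1 + p.2)) + f (m - s) =
    (∑ p ∈ Finset.HasAntidiagonal.antidiagonal s, f (m - p.1 + p.2)) + f (m + s + 2) := by
  rw [Finset.Nat.sum_antidiagonal_eq_sum_range_succ_mk,
    Finset.Nat.sum_antidiagonal_eq_sum_range_succ_mk]
  rw [Finset.sum_range_succ', Finset.sum_range_succ]
  have : ∑ k ∈ Finset.range s, f (m + 2 - ((k + 1 : ℕ) : ℤ) + ((s - (k + 1) : ℕ) : ℤ))
      = ∑ k ∈ Finset.range s, f (m - (k : ℤ) + ((s - k : ℕ) : ℤ)) := by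
    apply Finset.sum_congr rfl
    intro k hk
    rw [Finset.mem_range] at hk
    congr 1
    omega
  simp only [this]
  have e1 : m + 2 - ((0 : ℕ) : ℤ) + ((s - 0 : ℕ) : ℤ) = m + s + 2 := by
    simp; ring
  have e2 : m - (s : ℤ) + ((s - s : ℕ) : ℤ) = m - s := by simp
  rw [e1, e2]
  ring

lemma good_chi {f : ℤ → ℕ} (hf : Good f) (s : ℕ) :
    Good (fun m => ∑ p ∈ Finset.HasAntidiagonal.antidiagonal s, f (m - p.1 + p.2)) := by
  constructor
  · intro m
    simp only
    rw [← Finset.Nat.sum_antidiagonal_swap]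
    apply Finset.sum_congr rfl
    intro p _
    rw [← hf.1]
    congr 1
    simp; ring
  · intro m hm
    have h1 := chi_tel f s m
    have h2 := hf.le' m s hm
    simp only
    omega

lemma Good.add {f g : ℤ → ℕ} (hf : Good f) (hg : Good g) : Good (fun m => f m + g m) :=
  ⟨fun m => by simp only [hf.1, hg.1], fun m hm => add_le_add (hf.2 m hm) (hg.2 m hm)⟩

lemma Good.mul {f : ℤ → ℕ} (hf : Good f) (c : ℕ) : Good (fun m => c * f m) :=
  ⟨fun m => by simp only [hf.1], fun m hm => Nat.mul_le_mul_left c (hf.2 m hm)⟩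

lemma good_w {f : ℤ → ℕ} (hf : Good f) (s : ℕ) :
    Good (fun m => ∑ p ∈ Finset.HasAntidiagonal.antidiagonal s, w p * f (m - p.1 + p.2)) := by
  match s with
  | 0 => simpa [w] using hf
  | 1 =>
    convert (good_chi hf 1).mul 2 using 2 with m
    simp [Finset.Nat.antidiagonal_succ, w]
    ring
  | s + 2 =>
    convert ((good_chi hf (s + 2)).mul 2).add ((good_chi hf s).mul 2) using 2 with m
    rw [Finset.Nat.antidiagonal_succ_succ']
    simp [w]
    rw [← Finset.mul_sum]
    have : ∀ x : ℕ × ℕ, m - ((x.1 : ℤ) + 1) + ((x.2 : ℤ) + 1) = m - x.1 + x.2 := by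
      intro x; ring
    simp only [this]
    ring

lemma good_wCorner {f : ℤ → ℕ} (hf : Good f) (s : ℕ) :
    Good (fun m => ∑ p ∈ Finset.HasAntidiagonal.antidiagonal s, wCorner p * f (m - p.1 + p.2)) := by
  match s with
  | 0 => simpa [wCorner] using hf.mul 2
  | s + 1 =>
    convert good_w hf (s + 1) using 2 with m
    apply Finset.sum_congr rfl
    intro p hp
    rw [Finset.HasAntidiagonal.mem_antidiagonal] at hp
    have : p ≠ (0, 0) := by rintro rfl; simp at hp
    simp [wCorner, this]

lemma sum_LL_cons (s : ℕ) (t : List ℕ) (g : List (ℕ × ℕ) → ℕ) :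
    ∑ l ∈ LL (s :: t), g l = ∑ p ∈ Finset.HasAntidiagonal.antidiagonal s, ∑ l ∈ LL t, g (p :: l) := by
  rw [LL, Finset.sum_image, Finset.sum_product]
  rintro ⟨a, b⟩ _ ⟨c, d⟩ _ h
  simpa using h

lemma good_W (s : List ℕ) : Good (fun m => ∑ l ∈ LL s, if rk l = m then W l else 0) := by
  induction s with
  | nil =>
    constructor
    · intro m
      have h : (0 : ℤ) = -m ↔ (0 : ℤ) = m := by omega
      simp only [LL, Finset.sum_singleton]
      exact if_congr h rfl rfl
    · intro m hm
      simp only [LL, Finset.sum_singleton]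
      have h : ¬ rk [] = m + 2 := by simp only [rk]; omega
      rw [if_neg h]; exact Nat.zero_le _
  | cons s t ih =>
    convert good_w ih s using 2 with m
    rw [sum_LL_cons]
    apply Finset.sum_congr rfl
    intro p _
    rw [Finset.mul_sum]
    apply Finset.sum_congr rfl
    intro l _
    have : rk (p :: l) = m ↔ rk l = m - p.1 + p.2 := by
      simp only [rk]; constructor <;> intro h <;> linarith
    simp [this, W]

lemma good_WTot (s : List ℕ) : Good (fun m => ∑ l ∈ LL s, if rk l = m then WTot l else 0) := by
  cases s with
  | nil => simpa [LL, W, WTot] using good_W []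
  | cons s t =>
    convert good_wCorner (good_W t) s using 2 with m
    rw [sum_LL_cons]
    apply Finset.sum_congr rfl
    intro p _
    rw [Finset.mul_sum]
    apply Finset.sum_congr rfl
    intro l _
    have : rk (p :: l) = m ↔ rk l = m - p.1 + p.2 := by
      simp only [rk]; constructor <;> intro h <;> linarith
    simp [this, WTot]

/-- Weight of a multiset. -/
def gw (m : ℤ) (M : Multiset ℕ) : ℕ :=
  if (M.sup : ℤ) - Multiset.card M = m then 2 ^ M.toFinset.card else 0

lemma overN_eq (m : ℤ) (n : ℕ) : overN m n = ∑ p : n.Partition, gw m p.parts := by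
  classical
  have : {p : n.Partition × Finset ℕ |
      p.2 ⊆ p.1.parts.toFinset ∧ (p.1.parts.sup : ℤ) - Multiset.card p.1.parts = m} =
      (((Finset.univ.filter (fun p : n.Partition =>
        (p.parts.sup : ℤ) - Multiset.card p.parts = m)).sigma
        (fun p => p.parts.toFinset.powerset)).map
        (Equiv.sigmaEquivProd n.Partition (Finset ℕ)).toEmbedding :
          Finset (n.Partition × Finset ℕ)) := by
    ext ⟨p, S⟩
    simp [Equiv.sigmaEquivProd]
    tauto
  rw [overN, this, Set.ncard_coe_finset, Finset.card_map, Finset.card_sigma, Finset.sum_filter]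
  simp only [Finset.card_powerset, gw]

end OverN

open OverN in
theorem overN_antitone (m : ℤ) (hm : 0 ≤ m) (n : ℕ) : overN (m + 2) n ≤ overN m n := by
  classical
  rw [overN_eq, overN_eq]
  have hex : ∀ p : n.Partition, ∃ l, Lam l = p.parts := fun p =>
    Lam_surj p.parts fun x hx => p.parts_pos hx
  choose Phi hPhi using hex
  have key : ∀ k : ℤ, ∑ p : n.Partition, gw k p.parts =
      ∑ s ∈ Finset.univ.image (fun p : n.Partition => sg (Phi p)),
        ∑ l ∈ LL s, if rk l = k then WTot l else 0 := by
    intro k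
    rw [← Finset.sum_fiberwise_of_maps_to
      (fun p _ => Finset.mem_image_of_mem (fun p : n.Partition => sg (Phi p)) (Finset.mem_univ p))]
    apply Finset.sum_congr rfl
    intro s hs
    obtain ⟨p0, -, hp0⟩ := Finset.mem_image.1 hs
    refine Finset.sum_bij (fun p _ => Phi p) ?_ ?_ ?_ ?_
    · intro p hp
      rw [mem_LL]
      exact (Finset.mem_filter.1 hp).2
    · intro p _ p' _ h
      have h' : p.parts = p'.parts := by rw [← hPhi, ← hPhi, h]
      exact Nat.Partition.ext h'
    · intro l hl
      rw [mem_LL] at hl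
      have hlen : l.length = (Phi p0).length := by
        have := congrArg List.length (hl.trans hp0.symm)
        simpa [sg] using this
      have hsum : (Lam l).sum = n := by
        rw [sum_Lam, hl, ← hp0, hlen, ← sum_Lam, hPhi, p0.parts_sum]
      have hpos : ∀ {x}, x ∈ Lam l → 0 < x := by
        intro x hx
        rw [Lam, Multiset.mem_add] at hx
        rcases hx with hx | hx
        · obtain ⟨y, hy, rfl⟩ := Multiset.mem_map.1 hx
          have : 0 < (T l).card := Multiset.card_pos_iff_exists_mem.2 ⟨y, hy⟩
          rw [card_T] at this
          omega
        · exact (mem_B _ _ hx).1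
      have hP : Phi ⟨Lam l, hpos, hsum⟩ = l := Lam_inj (hPhi _)
      exact ⟨⟨Lam l, hpos, hsum⟩, by simp [hP, hl], hP⟩
    · intro p _
      rw [← hPhi p, gw, rk_Lam, card_Lam]
  rw [key, key]
  exact Finset.sum_le_sum fun s _ => (good_WTot s).2 m hm
end

section
/- Let N̄2(m,n) denote the number of overpartitions of n with M₂-rank m. Then for all integers m ≥ 0 and n ≥ 0, N̄2(m,n) ≥ N̄2(m+2,n). -/
/-- The M₂-rank of an overpartition, modeled as a pair `(λ, S)` of a partition `λ` of `n`
and a set `S` of overlined part sizes: it is `⌊λ₁/2⌋ - ℓ(λ) + ℓ(λ_o) - χ(λ)`, where `λ₁`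
is the largest part, `ℓ(λ)` the number of parts, `ℓ(λ_o)` the number of non-overlined odd
parts (the odd parts minus the overlined odd sizes), and `χ(λ) = 1` iff the largest part
is odd and non-overlined. -/
def m2Rank {n : ℕ} (p : n.Partition × Finset ℕ) : ℤ :=
  ((p.1.parts.sup / 2 : ℕ) : ℤ) - Multiset.card p.1.parts
    + ((Multiset.card (p.1.parts.filter (fun x => x % 2 = 1)) : ℤ)
        - ((p.2.filter (fun x => x % 2 = 1)).card : ℤ))
    - (if p.1.parts.sup % 2 = 1 ∧ p.1.parts.sup ∉ p.2 then 1 else 0)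

/-- `overN2 m n` is the number of overpartitions of `n` (pairs `(λ, S)` with `S` a subset
of the part sizes of `λ`, the overlined sizes) whose M₂-rank equals `m`. -/
noncomputable def overN2 (m : ℤ) (n : ℕ) : ℕ :=
  Set.ncard {p : n.Partition × Finset ℕ | p.2 ⊆ p.1.parts.toFinset ∧ m2Rank p = m}

open LaurentPolynomial in
/-- The characters `T^i + T^(i-2) + ... + T^(-i)`. -/
noncomputable def chr (i : ℕ) : ℤ[T;T⁻¹] := ∑ l ∈ Finset.range (i + 1), T ((i : ℤ) - 2 * l)

open LaurentPolynomial in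
theorem chr_zero : chr 0 = 1 := by simp [chr, T_zero]

open LaurentPolynomial in
theorem chr_succ (i : ℕ) : chr (i + 1) = T ((i : ℤ) + 1) + T (-1) * chr i := by
  unfold chr
  rw [Finset.sum_range_succ', Finset.mul_sum]
  refine (add_comm _ _).trans ?_
  refine congrArg₂ (· + ·) ?_ ?_
  · congr 1
  · refine Finset.sum_congr rfl fun l _ => ?_
    rw [← T_add]; congr 1; push_cast; ring

open LaurentPolynomial in
theorem chr_succ_right (i : ℕ) : chr (i + 1) = T 1 * chr i + T (-((i : ℤ) + 1)) := by
  unfold chr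
  rw [Finset.sum_range_succ, Finset.mul_sum]
  congr 1
  · refine Finset.sum_congr rfl fun l _ => ?_
    rw [← T_add]; congr 1; push_cast; ring
  · push_cast; congr 1; ring

open LaurentPolynomial in
theorem chr_add (i j : ℕ) :
    chr (i + j + 1) = T ((i : ℤ) + 1) * chr j + T (-((j : ℤ) + 1)) * chr i := by
  induction i with
  | zero => simp [chr_zero, chr_succ_right]
  | succ i ih =>
    rw [show i + 1 + j + 1 = (i + j + 1) + 1 by ring, chr_succ_right, ih, chr_succ_right i]
    have e1 : (T 1 : ℤ[T;T⁻¹]) * T ((i:ℤ) + 1) = T (((i + 1 : ℕ) : ℤ) + 1) := by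
      rw [← T_add]; congr 1; push_cast; ring
    have e2 : (T (-((j:ℤ) + 1)) : ℤ[T;T⁻¹]) * T (-((i:ℤ) + 1))
        = T (-(((i + j + 1 : ℕ) : ℤ) + 1)) := by
      rw [← T_add]; congr 1; push_cast; ring
    linear_combination chr j * e1 - e2

open LaurentPolynomial in
theorem chr_mul (i j : ℕ) : chr (i + 1) * chr (j + 1) = chr i * chr j + chr (i + j + 2) := by
  have h := chr_add i (j + 1)
  rw [show i + (j + 1) + 1 = i + j + 2 by ring] at h
  have e2 : (T (-1) : ℤ[T;T⁻¹]) * T (-((j:ℤ) + 1)) = T (-(((j + 1 : ℕ) : ℤ) + 1)) := by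
    rw [← T_add]; congr 1; push_cast; ring
  have e3 : (T (-1) : ℤ[T;T⁻¹]) * T 1 = 1 := by
    rw [← T_add]; simp [T_zero]
  rw [h]
  linear_combination chr (j + 1) * chr_succ i + T (-1) * chr i * chr_succ_right j
    + chr i * e2 + chr i * chr j * e3

open LaurentPolynomial in
/-- Generators of the cone. -/
def coneGen : Set ℤ[T;T⁻¹] := {f | ∃ i j : ℕ, f = T (-(j : ℤ)) * chr i}

open LaurentPolynomial in
theorem chr_mul_mem (i : ℕ) : ∀ j k : ℕ,
    T (-(k : ℤ)) * (chr i * chr j) ∈ AddSubmonoid.closure coneGen := by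
  induction i with
  | zero =>
    intro j k
    rw [chr_zero, one_mul]
    exact AddSubmonoid.subset_closure ⟨j, k, rfl⟩
  | succ i ih =>
    intro j k
    cases j with
    | zero =>
      rw [chr_zero, mul_one]
      exact AddSubmonoid.subset_closure ⟨i + 1, k, rfl⟩
    | succ j =>
      rw [chr_mul, mul_add]
      exact add_mem (ih j k) (AddSubmonoid.subset_closure ⟨_, k, rfl⟩)

open LaurentPolynomial in
/-- The cone of Laurent polynomials spanned by `T^(-j) * chr i`, a semiring. -/
def cone : Subsemiring ℤ[T;T⁻¹] where
  carrier := AddSubmonoid.closure coneGen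
  zero_mem' := zero_mem _
  add_mem' := add_mem
  one_mem' := AddSubmonoid.subset_closure ⟨0, 0, by simp [chr_zero, T_zero]⟩
  mul_mem' := by
    intro a b ha hb
    simp only [SetLike.mem_coe] at *
    induction ha using AddSubmonoid.closure_induction with
    | zero => simp
    | add x y _ _ hx hy => rw [add_mul]; exact add_mem hx hy
    | mem x hx =>
      obtain ⟨i, j, rfl⟩ := hx
      induction hb using AddSubmonoid.closure_induction with
      | zero => simp
      | add x y _ _ hx hy => rw [mul_add]; exact add_mem hx hy
      | mem x hx =>
        obtain ⟨k, l, rfl⟩ := hx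
        have := chr_mul_mem i k (j + l)
        convert this using 1
        have e : (T (-((j + l : ℕ) : ℤ)) : ℤ[T;T⁻¹]) = T (-(j:ℤ)) * T (-(l:ℤ)) := by
          rw [← T_add]; congr 1; push_cast; ring
        rw [e]; ring

open LaurentPolynomial in
theorem gen_mem_cone (i j : ℕ) : T (-(j : ℤ)) * chr i ∈ cone :=
  AddSubmonoid.subset_closure ⟨i, j, rfl⟩

open LaurentPolynomial in
theorem chr_mem_cone (i : ℕ) : chr i ∈ cone := by
  simpa [T_zero] using gen_mem_cone i 0

open LaurentPolynomial in
theorem w_mem_cone : (T (-1) : ℤ[T;T⁻¹]) ∈ cone := by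
  simpa [chr_zero] using gen_mem_cone 0 1

open LaurentPolynomial in
theorem cone_coeff {f : ℤ[T;T⁻¹]} (hf : f ∈ cone) (m : ℤ) (hm : 0 ≤ m) :
    f.coeff (m + 2) ≤ f.coeff m := by
  change f ∈ AddSubmonoid.closure coneGen at hf
  induction hf using AddSubmonoid.closure_induction with
  | zero => simp
  | add x y _ _ hx hy => simp; linarith
  | mem x hx =>
    obtain ⟨i, j, rfl⟩ := hx
    unfold chr
    simp only [Finset.mul_sum, ← T_add, AddMonoidAlgebra.coeff_sum, Finsupp.finsetSum_apply,
      T_apply]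
    rw [Finset.sum_range_succ, Finset.sum_range_succ', if_neg (by omega)]
    refine add_le_add (le_of_eq (Finset.sum_congr rfl fun l _ => ?_)) (by split_ifs <;> simp)
    refine if_congr ?_ rfl rfl
    push_cast
    constructor <;> intro h <;> linarith

section QSeries

variable {A : Type*} [CommRing A]

/-- The basic finite product. -/
def tau (w x p : A) (gw gx : ℕ → A) (b i h : ℕ) : A :=
  ∏ k ∈ Finset.range h,
    ((1 + w * x * p ^ k) * (1 + w * p ^ (b + 1 + k)) * gw (i + 1 + k) * gx (b + 1 + k))

/-- The truncated sum attached to `tau`. -/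
def gsum (w x p : A) (gw gx : ℕ → A) (b i H : ℕ) (t : A) : A :=
  ∑ h ∈ Finset.range H, t ^ h * tau w x p gw gx b i h

theorem tau_succ (w x p : A) (gw gx : ℕ → A) (b i h : ℕ) :
    tau w x p gw gx b i (h + 1) = tau w x p gw gx b i h *
      ((1 + w * x * p ^ h) * (1 + w * p ^ (b + 1 + h)) * gw (i + 1 + h) * gx (b + 1 + h)) := by
  simp [tau, Finset.prod_range_succ]

theorem tau_shift_i (w x p : A) (gw gx : ℕ → A) (hw : ∀ k, 1 ≤ k → gw k * (1 - w * p ^ k) = 1)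
    (b i h : ℕ) :
    tau w x p gw gx b i h
      = (1 - w * p ^ (i + 1 + h)) * gw (i + 1) * tau w x p gw gx b (i + 1) h := by
  induction h with
  | zero =>
    simp only [tau, Finset.range_zero, Finset.prod_empty]
    linear_combination -hw (i + 1) (by omega)
  | succ h ih =>
    rw [tau_succ, tau_succ, ih]
    have h1 := hw (i + 1 + h) (by omega)
    have h2 := hw (i + 1 + 1 + h) (by omega)
    rw [show i + 1 + (h + 1) = i + 1 + 1 + h by ring]
    generalize gw (i + 1 + h) = a at *
    generalize gw (i + 1 + 1 + h) = c at *
    generalize p ^ (i + 1 + h) = P at *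
    generalize p ^ (i + 1 + 1 + h) = Q at *
    generalize tau w x p gw gx b (i + 1) h = t
    generalize (1 + w * x * p ^ h) * (1 + w * p ^ (b + 1 + h)) = u
    linear_combination gw (i + 1) * t * u * gx (b + 1 + h) * (h1 - h2)

theorem tau_shift_b (w x p : A) (gw gx : ℕ → A) (b i h : ℕ) :
    (1 + w * p ^ (b + 1)) * gx (b + 1) * tau w x p gw gx (b + 1) i h
      = (1 + w * p ^ (b + 1 + h)) * gx (b + 1 + h) * tau w x p gw gx b i h := by
  induction h with
  | zero => simp [tau]
  | succ h ih =>
    rw [tau_succ, tau_succ]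
    rw [show b + 1 + (h + 1) = b + 1 + 1 + h by ring]
    linear_combination ((1 + w * x * p ^ h) * (1 + w * p ^ (b + 1 + 1 + h)) * gw (i + 1 + h)
      * gx (b + 1 + 1 + h)) * ih

theorem tau_diff (w x p : A) (gw gx : ℕ → A) (hw : ∀ k, 1 ≤ k → gw k * (1 - w * p ^ k) = 1)
    (hx : ∀ k, gx k * (1 - x * p ^ k) = 1) (b i h : ℕ) :
    tau w x p gw gx b i (h + 1) - tau w x p gw gx b i h
      = gw (i + 1) * (w * p ^ (h + 1) * (p ^ b + p ^ i) * tau w x p gw gx b (i + 1) h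
        + x * p ^ h * (w + p ^ (b + 1)) * ((1 + w * p ^ (b + 1)) * gx (b + 1))
          * tau w x p gw gx (b + 1) (i + 1) h) := by
  rw [tau_succ, tau_shift_i w x p gw gx hw b i h]
  have hB := tau_shift_b w x p gw gx b (i + 1) h
  have h1 := hw (i + 1 + h) (by omega)
  have h2 := hx (b + 1 + h)
  have e1 : p ^ (i + 1 + h) = p ^ h * p * p ^ i := by ring
  have e2 : p ^ (b + 1 + h) = p ^ h * p * p ^ b := by ring
  have e3 : p ^ (h + 1) = p ^ h * p := by ring
  have e4 : p ^ (b + 1) = p ^ b * p := by ring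
  rw [e1] at h1
  rw [e2] at h2 hB
  rw [e1, e2, e3, e4]
  rw [e4] at hB
  generalize gw (i + 1 + h) = a at *
  generalize gw (i + 1) = d at *
  generalize gx (b + 1 + h) = c at *
  generalize tau w x p gw gx b (i + 1) h = t at *
  generalize tau w x p gw gx (b + 1) (i + 1) h = s at *
  generalize p ^ h = Ph at *
  generalize p ^ i = Pi at *
  generalize p ^ b = Pb at *
  linear_combination d * t * (1 + w * x * Ph) * (1 + w * (Ph * p * Pb)) * c * h1
    - d * (x * Ph * (w + Pb * p)) * hB + d * t * (1 + w * (Ph * p * Pb)) * h2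

theorem gsum_abel (t : A) (f : ℕ → A) (hf : f 0 = 1) (H : ℕ) :
    (1 - t) * ∑ h ∈ Finset.range (H + 1), t ^ h * f h
      = 1 + t * ∑ h ∈ Finset.range H, t ^ h * (f (h + 1) - f h) - t ^ (H + 1) * f H := by
  induction H with
  | zero => simp [hf]
  | succ H ih =>
    rw [Finset.sum_range_succ, mul_add, ih, Finset.sum_range_succ _ H]
    ring

theorem gsum_rec (w x p : A) (gw gx : ℕ → A) (hw : ∀ k, 1 ≤ k → gw k * (1 - w * p ^ k) = 1)
    (hx : ∀ k, gx k * (1 - x * p ^ k) = 1) (b i H : ℕ) (t : A) :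
    (1 - t) * gsum w x p gw gx b i (H + 1) t
      = 1 + t * gw (i + 1) * (w * p * (p ^ b + p ^ i) * gsum w x p gw gx b (i + 1) H (t * p)
        + x * (w + p ^ (b + 1)) * ((1 + w * p ^ (b + 1)) * gx (b + 1))
          * gsum w x p gw gx (b + 1) (i + 1) H (t * p))
        - t ^ (H + 1) * tau w x p gw gx b i H := by
  unfold gsum
  rw [gsum_abel t _ (by simp [tau])]
  congr 2
  rw [mul_assoc]
  congr 1
  simp only [Finset.mul_sum]
  rw [← Finset.sum_add_distrib, Finset.mul_sum]
  refine Finset.sum_congr rfl fun h _ => ?_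
  rw [tau_diff w x p gw gx hw hx]
  ring

theorem rec0 (z w x p : A) (gw gz gx : ℕ → A) (hzw : z * w = 1)
    (hw : ∀ k, 1 ≤ k → gw k * (1 - w * p ^ k) = 1)
    (hz : ∀ k, 1 ≤ k → gz k * (1 - z * p ^ k) = 1)
    (hx : ∀ k, gx k * (1 - x * p ^ k) = 1) (b i H : ℕ) (hi : 1 ≤ i) :
    gw i * gsum w x p gw gx b i (H + 1) (z * p ^ i)
      = (gz i * gw i) * (1 + p ^ (i + 1) * (p ^ b + p ^ i)
          * (gw (i + 1) * gsum w x p gw gx b (i + 1) H (z * p ^ (i + 1)))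
        + x * p ^ i * ((1 + z * p ^ (b + 1)) * (1 + w * p ^ (b + 1))) * gx (b + 1)
          * (gw (i + 1) * gsum w x p gw gx (b + 1) (i + 1) H (z * p ^ (i + 1))))
        - p ^ (i * (H + 1)) * (gw i * gz i * z ^ (H + 1) * tau w x p gw gx b i H) := by
  have h := gsum_rec w x p gw gx hw hx b i H (z * p ^ i)
  have h1 := hz i hi
  rw [show z * p ^ i * p = z * p ^ (i + 1) by ring] at h
  have e : (z * p ^ i) ^ (H + 1) = p ^ (i * (H + 1)) * z ^ (H + 1) := by
    rw [mul_pow, ← pow_mul]; ring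
  rw [e] at h
  generalize gsum w x p gw gx b i (H + 1) (z * p ^ i) = s1 at *
  generalize gsum w x p gw gx b (i + 1) H (z * p ^ (i + 1)) = s2 at *
  generalize gsum w x p gw gx (b + 1) (i + 1) H (z * p ^ (i + 1)) = s3 at *
  generalize p ^ (i * (H + 1)) = P at *
  generalize z ^ (H + 1) = Z at *
  rw [pow_succ p b] at *
  rw [pow_succ p i] at *
  generalize p ^ i = Pi at *
  generalize p ^ b = Pb at *
  generalize gx (b + 1) = gxb at *
  generalize gw (i + 1) = d at *
  linear_combination gz i * gw i * h - gw i * s1 * h1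
    + gz i * gw i * d * (p * Pi * (Pb + Pi) * s2 + x * Pi * (1 + w * (Pb * p)) * gxb * s3) * hzw

theorem rec1 (z w x p : A) (gw gz gx : ℕ → A) (hzw : z * w = 1)
    (hw : ∀ k, 1 ≤ k → gw k * (1 - w * p ^ k) = 1)
    (hz : ∀ k, 1 ≤ k → gz k * (1 - z * p ^ k) = 1)
    (hx : ∀ k, gx k * (1 - x * p ^ k) = 1) (b i H : ℕ) :
    w * (gsum w x p gw gx b i (H + 1) (z * p ^ (i + 1)) - 1)
      = (gz (i + 1) * gw (i + 1)) * (p ^ (i + 1)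
          + (p ^ (i + 2 + i) + p ^ (i + 2 + b))
            * (w * (gsum w x p gw gx b (i + 1) H (z * p ^ (i + 2)) - 1))
          + w * p ^ (i + 2 + b)
          + x * p ^ (i + 1) * ((1 + z * p ^ (b + 1)) * (1 + w * p ^ (b + 1))) * gx (b + 1)
            * (w + w * (gsum w x p gw gx (b + 1) (i + 1) H (z * p ^ (i + 2)) - 1)))
        - p ^ ((i + 1) * (H + 1))
          * (w * gz (i + 1) * z ^ (H + 1) * tau w x p gw gx b i H) := by
  have h := gsum_rec w x p gw gx hw hx b i H (z * p ^ (i + 1))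
  have h1 := hz (i + 1) (by omega)
  have h2 := hw (i + 1) (by omega)
  rw [show z * p ^ (i + 1) * p = z * p ^ (i + 2) by ring] at h
  have e : (z * p ^ (i + 1)) ^ (H + 1) = p ^ ((i + 1) * (H + 1)) * z ^ (H + 1) := by
    rw [mul_pow, ← pow_mul]; ring
  rw [e] at h
  generalize gsum w x p gw gx b i (H + 1) (z * p ^ (i + 1)) = s1 at *
  generalize gsum w x p gw gx b (i + 1) H (z * p ^ (i + 2)) = s2 at *
  generalize gsum w x p gw gx (b + 1) (i + 1) H (z * p ^ (i + 2)) = s3 at *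
  generalize p ^ ((i + 1) * (H + 1)) = P at *
  generalize z ^ (H + 1) = Z at *
  generalize gx (b + 1) = gxb at *
  generalize gw (i + 1) = d at *
  generalize gz (i + 1) = c at *
  rw [show p ^ (i + 2 + i) = p ^ i * p ^ i * p * p by ring,
    show p ^ (i + 2 + b) = p ^ i * p ^ b * p * p by ring]
  rw [pow_succ p b] at *
  rw [pow_succ p i] at *
  generalize p ^ i = Pi at *
  generalize p ^ b = Pb at *
  linear_combination w * c * h - w * s1 * h1 + w * h1 - c * (Pi * p) * h2 + (c * (Pi * p)
    + c * d * (Pi * p) * p * (Pb + Pi) * w * s2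
    + c * d * x * (Pi * p) * (1 + w * (Pb * p)) * gxb * s3 * w) * hzw

end QSeries

section ConeSeries

open LaurentPolynomial

/-- The series `∑ a_n X^(k n)`. -/
noncomputable def ser (a : ℕ → ℤ[T;T⁻¹]) (k : ℕ) : PowerSeries ℤ[T;T⁻¹] :=
  PowerSeries.mk fun n => if k ∣ n then a (n / k) else 0

/-- The geometric series `1 / (1 - u X^k)`. -/
noncomputable def geo (u : ℤ[T;T⁻¹]) (k : ℕ) : PowerSeries ℤ[T;T⁻¹] := ser (fun n => u ^ n) k

theorem ser_mul (a a' : ℕ → ℤ[T;T⁻¹]) (u : ℤ[T;T⁻¹]) (k : ℕ) (hk : 1 ≤ k) (h0 : a' 0 = a 0)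
    (h1 : ∀ n, a' (n + 1) = a (n + 1) - u * a n) :
    ser a k * (1 - PowerSeries.C u * PowerSeries.X ^ k) = ser a' k := by
  ext1 n
  rw [mul_sub, mul_one, ← mul_assoc, map_sub, PowerSeries.coeff_mul_X_pow']
  rw [PowerSeries.coeff_mul_C]
  simp only [ser, PowerSeries.coeff_mk]
  by_cases hd : k ∣ n
  · obtain ⟨c, rfl⟩ := hd
    cases c with
    | zero => simp [h0, show ¬ k ≤ 0 by omega]
    | succ c =>
      have e : k * (c + 1) - k = k * c := by rw [mul_add, mul_one]; omega
      have e1 : k ≤ k * (c + 1) := by nlinarith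
      simp only [e, e1, dvd_mul_right, if_true]
      rw [Nat.mul_div_cancel_left _ (by omega), Nat.mul_div_cancel_left _ (by omega), h1]
      ring
  · simp only [hd, if_false]
    split_ifs with h2 h3
    · exact absurd ((Nat.dvd_sub_iff_left h2 dvd_rfl).1 h3) hd
    · simp
    · simp

theorem ser_one (k : ℕ) (hk : 1 ≤ k) : ser (fun n => if n = 0 then 1 else 0) k = 1 := by
  ext1 n
  simp only [ser, PowerSeries.coeff_mk, PowerSeries.coeff_one]
  by_cases hn : n = 0
  · simp [hn]
  · by_cases hd : k ∣ n
    · have : n / k ≠ 0 := by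
        have := Nat.div_pos (Nat.le_of_dvd (by omega) hd) (by omega)
        omega
      simp [hn, this]
    · simp [hn, hd]

theorem geo_mul (u : ℤ[T;T⁻¹]) (k : ℕ) (hk : 1 ≤ k) :
    geo u k * (1 - PowerSeries.C u * PowerSeries.X ^ k) = 1 := by
  refine Eq.trans ?_ (ser_one k hk)
  unfold geo
  apply ser_mul (fun n => u ^ n) (fun n => if n = 0 then 1 else 0) u k hk
  · simp
  · intro n
    rw [if_neg (by omega), pow_succ, mul_comm, sub_self]

theorem geo_geo (k : ℕ) (hk : 1 ≤ k) : geo (T 1) k * geo (T (-1)) k = ser chr k := by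
  have h : ser chr k * (1 - PowerSeries.C (T 1) * PowerSeries.X ^ k) = geo (T (-1)) k := by
    unfold geo
    apply ser_mul chr (fun n => T (-1) ^ n) (T 1) k hk (by simp [chr_zero])
    intro n
    rw [chr_succ_right, T_pow]
    have : ((n + 1 : ℕ) : ℤ) * (-1) = -((n : ℤ) + 1) := by push_cast; ring
    rw [this]; ring
  have h2 := geo_mul (T 1) k hk
  linear_combination ser chr k * h2 - geo (T 1) k * h

/-- Series whose first `H` coefficients lie in the cone. -/
def KN (H : ℕ) (f : PowerSeries ℤ[T;T⁻¹]) : Prop := ∀ n < H, PowerSeries.coeff n f ∈ cone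

theorem KN.add {H : ℕ} {f g : PowerSeries ℤ[T;T⁻¹]} (hf : KN H f) (hg : KN H g) :
    KN H (f + g) := by
  intro n hn
  rw [map_add]
  exact add_mem (hf n hn) (hg n hn)

theorem KN.mul {H : ℕ} {f g : PowerSeries ℤ[T;T⁻¹]} (hf : KN H f) (hg : KN H g) :
    KN H (f * g) := by
  intro n hn
  rw [PowerSeries.coeff_mul]
  refine sum_mem fun ij hij => ?_
  rw [Finset.HasAntidiagonal.mem_antidiagonal] at hij
  exact mul_mem (hf _ (by omega)) (hg _ (by omega))

theorem KN.of_le {H H' : ℕ} {f : PowerSeries ℤ[T;T⁻¹]} (hf : KN H f) (h : H' ≤ H) : KN H' f :=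
  fun n hn => hf n (by omega)

theorem KN_ser (H k : ℕ) (a : ℕ → ℤ[T;T⁻¹]) (ha : ∀ n, a n ∈ cone) : KN H (ser a k) := by
  intro n _
  simp only [ser, PowerSeries.coeff_mk]
  split_ifs
  · exact ha _
  · exact zero_mem _

theorem KN_geo_one (H k : ℕ) : KN H (geo 1 k) := KN_ser H k _ fun n => by simp [one_mem]

theorem KN_geo_w (H k : ℕ) : KN H (geo (T (-1)) k) :=
  KN_ser H k _ fun n => pow_mem w_mem_cone n

theorem KN_geo_geo (H k : ℕ) (hk : 1 ≤ k) : KN H (geo (T 1) k * geo (T (-1)) k) := by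
  rw [geo_geo k hk]
  exact KN_ser H k _ chr_mem_cone

theorem KN_C (H : ℕ) {a : ℤ[T;T⁻¹]} (ha : a ∈ cone) : KN H (PowerSeries.C a) := by
  intro n _
  rw [PowerSeries.coeff_C]
  split_ifs
  · exact ha
  · exact zero_mem _

theorem KN_one (H : ℕ) : KN H 1 := by
  simpa using KN_C H (one_mem cone)

theorem KN_X_mul {H k : ℕ} {f : PowerSeries ℤ[T;T⁻¹]} (hf : KN (H - k) f) :
    KN H (PowerSeries.X ^ k * f) := by
  intro n hn
  rw [PowerSeries.coeff_X_pow_mul']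
  split_ifs
  · exact hf _ (by omega)
  · exact zero_mem _

theorem KN_sub_X {H k : ℕ} {f g : PowerSeries ℤ[T;T⁻¹]} (hf : KN H f) (hk : H ≤ k) :
    KN H (f - PowerSeries.X ^ k * g) := by
  intro n hn
  rw [map_sub, PowerSeries.coeff_X_pow_mul', if_neg (by omega), sub_zero]
  exact hf n hn

theorem KN_X (H k : ℕ) : KN H (PowerSeries.X ^ k) := by
  simpa using KN_X_mul (H := H) (k := k) (KN_one _)

theorem KN_pair (H k : ℕ) : KN H ((1 + PowerSeries.C (T 1) * PowerSeries.X ^ k)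
    * (1 + PowerSeries.C (T (-1)) * PowerSeries.X ^ k)) := by
  have e : (T 1 * T (-1) : ℤ[T;T⁻¹]) = 1 := by rw [← T_add]; simp [T_zero]
  have e2 : chr 1 = T 1 + T (-1) := by
    rw [show (1 : ℕ) = 0 + 1 by rfl, chr_succ_right, chr_zero]; simp
  have : ((1 + PowerSeries.C (T 1) * PowerSeries.X ^ k)
    * (1 + PowerSeries.C (T (-1)) * PowerSeries.X ^ k) : PowerSeries ℤ[T;T⁻¹])
    = 1 + PowerSeries.X ^ k * PowerSeries.C (chr 1) + PowerSeries.X ^ (k + k) := by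
    have e3 : (PowerSeries.C (T 1) * PowerSeries.C (T (-1)) : PowerSeries ℤ[T;T⁻¹]) = 1 := by
      rw [← map_mul, e, map_one]
    rw [e2, map_add]
    linear_combination (PowerSeries.X ^ (k + k)) * e3
  rw [this]
  exact ((KN_one H).add ((KN_X H k).mul (KN_C H (chr_mem_cone 1)))).add (KN_X H _)

end ConeSeries

section Claims

open LaurentPolynomial

/-- The constant series `z`. -/
noncomputable def zc : PowerSeries ℤ[T;T⁻¹] := PowerSeries.C (T 1)

/-- The constant series `1/z`. -/
noncomputable def wc : PowerSeries ℤ[T;T⁻¹] := PowerSeries.C (T (-1))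

/-- The series `1 / (1 - q^(2k)/z)`. -/
noncomputable def gw (k : ℕ) : PowerSeries ℤ[T;T⁻¹] := geo (T (-1)) (2 * k)

/-- The series `1 / (1 - z q^(2k))`. -/
noncomputable def gz (k : ℕ) : PowerSeries ℤ[T;T⁻¹] := geo (T 1) (2 * k)

/-- The series `1 / (1 - q^(2k+1))`. -/
noncomputable def gx (k : ℕ) : PowerSeries ℤ[T;T⁻¹] := geo 1 (2 * k + 1)

/-- Specialised `tau`. -/
noncomputable def tauS (b i h : ℕ) : PowerSeries ℤ[T;T⁻¹] :=
  tau wc PowerSeries.X (PowerSeries.X ^ 2) gw gx b i h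

/-- Specialised `gsum`, at `t = z q^(2j)`. -/
noncomputable def gS (b i j H : ℕ) : PowerSeries ℤ[T;T⁻¹] :=
  gsum wc PowerSeries.X (PowerSeries.X ^ 2) gw gx b i H (zc * (PowerSeries.X ^ 2) ^ j)

theorem zc_mul_wc : zc * wc = 1 := by
  unfold zc wc
  rw [← map_mul, ← T_add]; simp [T_zero]

theorem gw_mul (k : ℕ) (hk : 1 ≤ k) : gw k * (1 - wc * (PowerSeries.X ^ 2) ^ k) = 1 := by
  rw [← pow_mul]
  exact geo_mul _ _ (by omega)

theorem gz_mul (k : ℕ) (hk : 1 ≤ k) : gz k * (1 - zc * (PowerSeries.X ^ 2) ^ k) = 1 := by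
  rw [← pow_mul]
  exact geo_mul _ _ (by omega)

theorem gx_mul (k : ℕ) : gx k * (1 - PowerSeries.X * (PowerSeries.X ^ 2) ^ k) = 1 := by
  have := geo_mul 1 (2 * k + 1) (by omega)
  rw [map_one, one_mul] at this
  rw [← pow_mul, ← pow_succ']
  exact this

theorem KN.congr {H : ℕ} {f g : PowerSeries ℤ[T;T⁻¹]} (hf : KN H f) (h : g = f) : KN H g :=
  h ▸ hf

theorem KN_succ {H : ℕ} {f : PowerSeries ℤ[T;T⁻¹]} (hf : KN H f) (k : ℕ) (hk : 1 ≤ k) :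
    KN (H + 1) (PowerSeries.X ^ k * f) :=
  KN_X_mul (hf.of_le (by omega))

theorem KN_pairS (H b : ℕ) : KN H ((1 + zc * (PowerSeries.X ^ 2) ^ (b + 1))
    * (1 + wc * (PowerSeries.X ^ 2) ^ (b + 1))) := by
  rw [← pow_mul]
  exact KN_pair H _

theorem KN_gz_gw (H i : ℕ) (hi : 1 ≤ i) : KN H (gz i * gw i) := KN_geo_geo H _ (by omega)

theorem KN_gx (H b : ℕ) : KN H (gx b) := KN_geo_one H _

theorem KN_gw (H b : ℕ) : KN H (gw b) := KN_geo_w H _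

theorem KN_wc (H : ℕ) : KN H wc := KN_C H w_mem_cone

theorem KN_p (H b : ℕ) : KN H ((PowerSeries.X ^ 2) ^ b) := by
  rw [← pow_mul]; exact KN_X H _

theorem claim0 (H : ℕ) : ∀ b i : ℕ, 1 ≤ i → KN H (gw i * gS b i i H) := by
  induction H with
  | zero => intro b i _ n hn; omega
  | succ H ih =>
    intro b i hi
    have hrec := rec0 zc wc PowerSeries.X (PowerSeries.X ^ 2) gw gz gx zc_mul_wc gw_mul gz_mul
      gx_mul b i H hi
    unfold gS
    rw [hrec]
    rw [← pow_mul _ 2 (i * (H + 1))]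
    refine KN_sub_X (((KN_gz_gw _ i hi)).mul (((KN_one _).add ?_).add ?_)) (by nlinarith)
    · exact KN.congr (KN_succ (((KN_p H b).add (KN_p H i)).mul (ih b (i + 1) (by omega)))
        (2 * (i + 1)) (by omega)) (by unfold gS; ring)
    · exact KN.congr (KN_succ (((KN_pairS H b).mul (KN_gx H (b + 1))).mul
        (ih (b + 1) (i + 1) (by omega))) (2 * i + 1) (by omega)) (by unfold gS; ring)

theorem claim1 (H : ℕ) : ∀ b i : ℕ, KN H (wc * (gS b i (i + 1) H - 1)) := by
  induction H with
  | zero => intro b i n hn; omega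
  | succ H ih =>
    intro b i
    have hrec := rec1 zc wc PowerSeries.X (PowerSeries.X ^ 2) gw gz gx zc_mul_wc gw_mul gz_mul
      gx_mul b i H
    unfold gS
    rw [hrec]
    rw [← pow_mul _ 2 ((i + 1) * (H + 1))]
    refine KN_sub_X ((KN_gz_gw _ (i + 1) (by omega)).mul
      ((((KN_p _ _).add ?_).add ((KN_wc _).mul (KN_p _ _))).add ?_)) (by nlinarith)
    · exact KN.congr (KN_succ (((KN_p H b).add (KN_p H i)).mul (ih b (i + 1)))
        (2 * (i + 2)) (by omega)) (by unfold gS; ring)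
    · exact KN.congr (KN_succ (((KN_pairS H b).mul (KN_gx H (b + 1))).mul
        ((KN_wc H).add (ih (b + 1) (i + 1)))) (2 * (i + 1) + 1) (by omega)) (by unfold gS; ring)

/-- The full (truncated) generating function. -/
noncomputable def FS (H : ℕ) : PowerSeries ℤ[T;T⁻¹] :=
  1 + gx 0 * (2 * PowerSeries.X ^ 2 * gw 1 * (gS 0 1 1 H + wc * PowerSeries.X * gS 0 1 2 H)
    + 2 * PowerSeries.X * wc * gS 0 0 1 H)

theorem KN_FS (H : ℕ) : KN H (FS H) := by
  have h2 : KN H 2 := by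
    rw [← one_add_one_eq_two]; exact (KN_one H).add (KN_one H)
  have hX : KN H PowerSeries.X := by simpa using KN_X H 1
  have h := (KN_one H).add ((KN_gx H 0).mul ((((h2.mul (KN_X H 2)).mul (claim0 H 0 1 le_rfl)).add
    (((h2.mul (KN_X H 3)).mul (KN_gw H 1)).mul ((KN_wc H).add (claim1 H 0 1)))).add
    ((h2.mul hX).mul ((KN_wc H).add (claim1 H 0 0)))))
  refine h.congr ?_
  unfold FS
  ring

end Claims

section GenFun

open LaurentPolynomial

/-- A finite product formula for generating functions of partitions with bounded parts. -/
theorem genFun_eq_prod (f : ℕ → ℕ → ℤ[T;T⁻¹]) (s : ℕ) (hf : ∀ i c, s < i → f i c = 0) :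
    Nat.Partition.genFun f
      = ∏ i ∈ Finset.range s, ser (fun c => if c = 0 then 1 else f (i + 1) c) (i + 1) := by
  let _ : TopologicalSpace ℤ[T;T⁻¹] := ⊥
  have : DiscreteTopology ℤ[T;T⁻¹] := ⟨rfl⟩
  open scoped PowerSeries.WithPiTopology in
  have h := Nat.Partition.hasProd_genFun f
  open scoped PowerSeries.WithPiTopology in
  have key : ∀ i, (1 + ∑' j, f (i + 1) (j + 1) •
      (PowerSeries.X : PowerSeries ℤ[T;T⁻¹]) ^ ((i + 1) * (j + 1)))
      = ser (fun c => if c = 0 then 1 else f (i + 1) c) (i + 1) := by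
    intro i
    ext1 n
    rw [map_add, (Nat.Partition.summable_genFun_term f i).map_tsum _
      (PowerSeries.WithPiTopology.continuous_coeff _ _)]
    simp only [ser, PowerSeries.coeff_mk, PowerSeries.coeff_smul, PowerSeries.coeff_X_pow,
      PowerSeries.coeff_one]
    by_cases hd : (i + 1) ∣ n
    · obtain ⟨c, rfl⟩ := hd
      rw [if_pos (dvd_mul_right _ _), Nat.mul_div_cancel_left _ (by omega)]
      cases c with
      | zero =>
        rw [tsum_eq_single 0]
        · simp
        · intro j _; simp
      | succ c =>
        rw [tsum_eq_single c]
        · simp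
        · intro j hj
          rw [if_neg, smul_zero]
          intro h
          exact hj (by simpa using (Nat.eq_of_mul_eq_mul_left (by omega) h).symm)
    · rw [if_neg hd, if_neg (fun h : n = 0 => hd (h ▸ dvd_zero _)), zero_add]
      rw [tsum_eq_single 0]
      · rw [if_neg (fun h : n = (i + 1) * (0 + 1) => hd (h ▸ dvd_mul_right _ _)), smul_zero]
      · intro j _
        rw [if_neg (fun h : n = (i + 1) * (j + 1) => hd (h ▸ dvd_mul_right _ _)), smul_zero]
  simp only [key] at h
  refine h.unique (hasProd_prod_of_ne_finset_one fun i hi => ?_)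
  rw [← ser_one (i + 1) (by omega)]
  congr 1
  funext c
  rw [hf (i + 1) c (by simpa [Nat.lt_succ_iff] using hi)]

/-- `1 + u X^k` as a `ser`. -/
theorem ser_lin (u : ℤ[T;T⁻¹]) (k : ℕ) (hk : 1 ≤ k) :
    ser (fun c => if c = 0 then 1 else if c = 1 then u else 0) k
      = 1 + PowerSeries.C u * PowerSeries.X ^ k := by
  ext1 n
  simp only [ser, PowerSeries.coeff_mk, map_add, PowerSeries.coeff_C_mul, PowerSeries.coeff_X_pow,
    PowerSeries.coeff_one]
  by_cases hd : k ∣ n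
  · obtain ⟨c, rfl⟩ := hd
    rw [if_pos (dvd_mul_right _ _), Nat.mul_div_cancel_left _ (by omega)]
    have h1 : k * c = 0 ↔ c = 0 := by
      rw [Nat.mul_eq_zero]
      constructor
      · rintro (h | h)
        · omega
        · exact h
      · exact Or.inr
    have h2 : k * c = k ↔ c = 1 := by
      constructor
      · intro h; exact Nat.eq_of_mul_eq_mul_left (show 0 < k by omega) (by simpa using h)
      · rintro rfl; simp
    simp only [h1, h2]
    by_cases h0 : c = 0
    · simp [h0]
    · simp [h0]
  · rw [if_neg hd, if_neg (fun h : n = 0 => hd (h ▸ dvd_zero _)), if_neg (fun h : n = k => hd (h ▸ dvd_rfl))]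
    simp

theorem ser_const (u : ℤ[T;T⁻¹]) (k : ℕ) (hk : 1 ≤ k) :
    ser (fun c => if c = 0 then 1 else u) k
      = (1 + PowerSeries.C (u - 1) * PowerSeries.X ^ k) * geo 1 k := by
  have h := ser_mul (fun c => if c = 0 then 1 else u)
    (fun c => if c = 0 then 1 else if c = 1 then u - 1 else 0) 1 k hk (by simp) (by
      intro n; cases n <;> simp)
  rw [ser_lin _ k hk] at h
  rw [← h, mul_assoc, mul_comm _ (geo 1 k), geo_mul 1 k hk, mul_one]

theorem ser_dbl (u : ℤ[T;T⁻¹]) (k : ℕ) (hk : 1 ≤ k) :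
    ser (fun c => if c = 0 then 1 else 2 * u ^ c) k
      = (1 + PowerSeries.C u * PowerSeries.X ^ k) * geo u k := by
  have h := ser_mul (fun c => if c = 0 then 1 else 2 * u ^ c)
    (fun c => if c = 0 then 1 else if c = 1 then u else 0) u k hk (by simp) (by
      intro n
      cases n with
      | zero => simp; ring
      | succ n => simp; ring)
  rw [ser_lin _ k hk] at h
  rw [← h, mul_assoc, mul_comm _ (geo u k), geo_mul u k hk, mul_one]

/-- Weight of a part size `i` occurring `c` times, below the largest part. -/
noncomputable def wlow (i c : ℕ) : ℤ[T;T⁻¹] := if i % 2 = 1 then 1 + T (-1) else 2 * T (-1) ^ c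

/-- Weight of the largest part size `i` occurring `c` times. -/
noncomputable def wtop (i c : ℕ) : ℤ[T;T⁻¹] := if i % 2 = 1 then 2 * T (-1) else 2 * T (-1) ^ c

/-- Weights for partitions with largest part `s`. -/
noncomputable def wt (s i c : ℕ) : ℤ[T;T⁻¹] :=
  if i < s then wlow i c else if i = s then wtop i c else 0

/-- Weights for partitions with largest part less than `s`. -/
noncomputable def wtl (s i c : ℕ) : ℤ[T;T⁻¹] := if i < s then wlow i c else 0

/-- Factor of a part size below the largest part. -/
noncomputable def fac (i : ℕ) : PowerSeries ℤ[T;T⁻¹] :=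
  ser (fun c => if c = 0 then 1 else wlow i c) i

/-- Product of the factors of part sizes `1, ..., s`. -/
noncomputable def PP (s : ℕ) : PowerSeries ℤ[T;T⁻¹] := ∏ i ∈ Finset.range s, fac (i + 1)

theorem genFun_wtl (s : ℕ) : Nat.Partition.genFun (wtl (s + 1)) = PP s := by
  rw [genFun_eq_prod _ s (by intro i c h; rw [wtl, if_neg (by omega)])]
  refine Finset.prod_congr rfl fun i hi => ?_
  rw [Finset.mem_range] at hi
  unfold fac
  congr 1
  funext c
  simp only [wtl, if_pos (show i + 1 < s + 1 by omega)]

theorem genFun_wt (s : ℕ) : Nat.Partition.genFun (wt (s + 1))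
    = PP s * ser (fun c => if c = 0 then 1 else wtop (s + 1) c) (s + 1) := by
  rw [genFun_eq_prod _ (s + 1) (by intro i c h; rw [wt, if_neg (by omega), if_neg (by omega)])]
  rw [Finset.prod_range_succ]
  congr 1
  · refine Finset.prod_congr rfl fun i hi => ?_
    rw [Finset.mem_range] at hi
    unfold fac
    congr 1
    funext c
    simp only [wt, if_pos (show i + 1 < s + 1 by omega)]
  · congr 1
    funext c
    simp only [wt, lt_irrefl, if_false, if_true]

theorem fac_odd (h : ℕ) :
    fac (2 * h + 1) = (1 + wc * PowerSeries.X * (PowerSeries.X ^ 2) ^ h) * gx h := by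
  unfold fac wlow
  simp only [show (2 * h + 1) % 2 = 1 by omega, if_true]
  rw [ser_const _ _ (by omega)]
  unfold gx wc
  rw [add_sub_cancel_left]
  ring

theorem fac_even (h : ℕ) :
    fac (2 * h + 2) = (1 + wc * (PowerSeries.X ^ 2) ^ (h + 1)) * gw (h + 1) := by
  unfold fac wlow
  simp only [show ¬ (2 * h + 2) % 2 = 1 by omega, if_false]
  rw [ser_dbl _ _ (by omega)]
  unfold gw wc
  ring_nf

/-- Generating function for partitions with largest part `s + 1`. -/
noncomputable def DD (s : ℕ) : PowerSeries ℤ[T;T⁻¹] :=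
  Nat.Partition.genFun (wt (s + 1)) - Nat.Partition.genFun (wtl (s + 1))

theorem DD_even (h : ℕ) :
    DD (2 * h) = PP (2 * h) * (2 * wc * PowerSeries.X * (PowerSeries.X ^ 2) ^ h * gx h) := by
  unfold DD
  rw [genFun_wt, genFun_wtl]
  have e : ser (fun c => if c = 0 then 1 else wtop (2 * h + 1) c) (2 * h + 1)
      = 1 + (2 * wc * PowerSeries.X * (PowerSeries.X ^ 2) ^ h * gx h) := by
    unfold wtop
    simp only [show (2 * h + 1) % 2 = 1 by omega, if_true]
    rw [ser_const _ _ (by omega)]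
    have h1 := gx_mul h
    unfold gx at *
    unfold wc
    rw [map_sub, map_mul, map_one, map_ofNat]
    linear_combination h1
  rw [e]; ring

theorem DD_odd (h : ℕ) :
    DD (2 * h + 1) = PP (2 * h + 1) * (2 * wc * (PowerSeries.X ^ 2) ^ (h + 1) * gw (h + 1)) := by
  unfold DD
  rw [genFun_wt, genFun_wtl]
  have e : ser (fun c => if c = 0 then 1 else wtop (2 * h + 1 + 1) c) (2 * h + 1 + 1)
      = 1 + (2 * wc * (PowerSeries.X ^ 2) ^ (h + 1) * gw (h + 1)) := by
    unfold wtop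
    simp only [show ¬ (2 * h + 1 + 1) % 2 = 1 by omega, if_false]
    rw [ser_dbl _ _ (by omega)]
    have h1 := gw_mul (h + 1) (by omega)
    unfold gw at *
    unfold wc at *
    rw [show 2 * (h + 1) = 2 * h + 1 + 1 by ring] at *
    linear_combination h1
  rw [e]; ring

theorem PP_even (h : ℕ) : PP (2 * h)
    = tauS 0 0 h * (1 - PowerSeries.X * (PowerSeries.X ^ 2) ^ h) * gx 0 := by
  induction h with
  | zero =>
    have := gx_mul 0
    simp only [PP, tauS, tau, mul_zero, Finset.range_zero, Finset.prod_empty]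
    linear_combination -this
  | succ h ih =>
    have e : PP (2 * (h + 1)) = PP (2 * h) * fac (2 * h + 1) * fac (2 * h + 2) := by
      unfold PP
      rw [show 2 * (h + 1) = 2 * h + 1 + 1 by ring, Finset.prod_range_succ, Finset.prod_range_succ]
    rw [e, ih, fac_odd, fac_even]
    unfold tauS
    rw [tau_succ]
    have h1 := gx_mul h
    have h2 := gx_mul (h + 1)
    rw [show 0 + 1 + h = h + 1 by ring]
    generalize tau wc PowerSeries.X (PowerSeries.X ^ 2) gw gx 0 0 h = t
    linear_combination t * gx 0 * (1 + wc * PowerSeries.X * (PowerSeries.X ^ 2) ^ h)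
      * (1 + wc * (PowerSeries.X ^ 2) ^ (h + 1)) * gw (h + 1) * (h1 - h2)

theorem PP_odd (h : ℕ) : PP (2 * h + 1)
    = tauS 0 0 h * gx 0 * (1 + wc * PowerSeries.X * (PowerSeries.X ^ 2) ^ h) := by
  have e : PP (2 * h + 1) = PP (2 * h) * fac (2 * h + 1) := by
    unfold PP
    rw [Finset.prod_range_succ]
  rw [e, PP_even, fac_odd]
  linear_combination tauS 0 0 h * gx 0 * (1 + wc * PowerSeries.X * (PowerSeries.X ^ 2) ^ h)
    * gx_mul h

theorem C_T_eq (h : ℕ) : (PowerSeries.C (T (h : ℤ)) : PowerSeries ℤ[T;T⁻¹]) = zc ^ h := by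
  unfold zc
  rw [← map_pow, T_pow, mul_one]

theorem FS_eq (H : ℕ) : FS H
    = 1 + ∑ s ∈ Finset.range (2 * H), PowerSeries.C (T (((s + 1) / 2 : ℕ) : ℤ)) * DD s := by
  induction H with
  | zero => simp [FS, gS, gsum]
  | succ H ih =>
    rw [show 2 * (H + 1) = 2 * H + 1 + 1 by ring, Finset.sum_range_succ, Finset.sum_range_succ,
      ← add_assoc, ← add_assoc, ← ih, show (2 * H + 1) / 2 = H by omega,
      show (2 * H + 1 + 1) / 2 = H + 1 by omega, C_T_eq, C_T_eq, DD_even, DD_odd, PP_even, PP_odd]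
    have hs : ∀ b i j, gS b i j (H + 1)
        = gS b i j H + zc ^ H * ((PowerSeries.X ^ 2) ^ j) ^ H * tauS b i H := by
      intro b i j
      unfold gS gsum tauS
      rw [Finset.sum_range_succ, mul_pow]
    unfold FS
    rw [hs, hs, hs]
    have h1 := gx_mul H
    have h2 := tau_shift_i wc PowerSeries.X (PowerSeries.X ^ 2) gw gx gw_mul 0 0 H
    change tauS 0 0 H = _ * tauS 0 1 H at h2
    have h3 := gw_mul (H + 1) (by omega)
    rw [show 0 + 1 + H = H + 1 by ring] at h2
    rw [zero_add] at h2
    rw [pow_succ _ H] at h2 h3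
    rw [pow_succ zc H, pow_succ (PowerSeries.X ^ 2) H, pow_one,
      pow_right_comm (PowerSeries.X ^ 2) 2 H, pow_two ((PowerSeries.X ^ 2) ^ H)]
    generalize ((PowerSeries.X ^ 2) ^ H : PowerSeries ℤ[T;T⁻¹]) = P at *
    generalize tauS 0 0 H = t0 at *
    generalize tauS 0 1 H = t1 at *
    generalize (PowerSeries.X : PowerSeries ℤ[T;T⁻¹]) ^ 2 = p at *
    linear_combination -(2 * zc ^ H * t0 * gx 0 * wc * PowerSeries.X * P) * h1
      + (2 * zc ^ H * p * P * gx 0 * (1 + wc * PowerSeries.X * P))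
        * (-(t0 * gw (H + 1)) * zc_mul_wc - gw (H + 1) * h2 - gw 1 * t1 * h3)

end GenFun

section Comb

open LaurentPolynomial

theorem T_finset_sum {ι : Type*} (s : Finset ι) (f : ι → ℤ) :
    (T (∑ i ∈ s, f i) : ℤ[T;T⁻¹]) = ∏ i ∈ s, T (f i) := by
  classical
  induction s using Finset.induction_on with
  | empty => simp [T_zero]
  | insert a s ha ih => rw [Finset.sum_insert ha, Finset.prod_insert ha, T_add, ih]

/-- Exponent contributed by an overlined part size. -/
def ea (c i : ℕ) : ℤ := if i % 2 = 1 then -1 else -(c : ℤ)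

/-- Exponent contributed by a part size that is not overlined. -/
def eb (s c i : ℕ) : ℤ := if i % 2 = 1 then (if i = s then -1 else 0) else -(c : ℤ)

theorem sup_mem {n : ℕ} (p : n.Partition) (h : p.parts.sup ≠ 0) : p.parts.sup ∈ p.parts := by
  have key : ∀ m : Multiset ℕ, m.sup ≠ 0 → m.sup ∈ m := by
    intro m
    induction m using Multiset.induction_on with
    | empty => simp
    | cons a m ih =>
      intro h
      rw [Multiset.sup_cons] at *
      rcases le_total a m.sup with hle | hle
      · rw [sup_eq_right.2 hle] at *
        exact Multiset.mem_cons_of_mem (ih h)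
      · rw [sup_eq_left.2 hle] at *
        exact Multiset.mem_cons_self _ _
  exact key _ h

theorem m2Rank_eq {n : ℕ} (p : n.Partition) (S : Finset ℕ) (hS : S ⊆ p.parts.toFinset) :
    m2Rank (p, S) = ((p.parts.sup / 2 : ℕ) : ℤ) + (∑ i ∈ S, ea (p.parts.count i) i
      + ∑ i ∈ p.parts.toFinset \ S, eb p.parts.sup (p.parts.count i) i) := by
  unfold m2Rank
  simp only
  set F := p.parts.toFinset with hF
  have h1 : (Multiset.card p.parts : ℤ) = ∑ i ∈ F, (p.parts.count i : ℤ) := by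
    rw [← Multiset.toFinset_sum_count_eq]; push_cast; rfl
  have h2 : (Multiset.card (p.parts.filter (fun x => x % 2 = 1)) : ℤ)
      = ∑ i ∈ F, (if i % 2 = 1 then (p.parts.count i : ℤ) else 0) := by
    rw [← Multiset.toFinset_sum_count_eq]
    push_cast
    rw [Multiset.toFinset_filter, Finset.sum_filter]
    refine Finset.sum_congr rfl fun i _ => ?_
    split_ifs with h
    · rw [Multiset.count_filter, if_pos h]
    · rfl
  have h3 : ((S.filter (fun x => x % 2 = 1)).card : ℤ)
      = ∑ i ∈ S, (if i % 2 = 1 then 1 else 0) := by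
    rw [Finset.card_filter]; push_cast; rfl
  have h4 : (if p.parts.sup % 2 = 1 ∧ p.parts.sup ∉ S then (1 : ℤ) else 0)
      = ∑ i ∈ F \ S, (if i % 2 = 1 ∧ i = p.parts.sup then 1 else 0) := by
    by_cases hc : p.parts.sup % 2 = 1 ∧ p.parts.sup ∉ S
    · rw [if_pos hc, Finset.sum_eq_single p.parts.sup]
      · simp [hc.1]
      · intro b _ hb; simp [hb]
      · intro hn
        refine absurd (Finset.mem_sdiff.2 ⟨?_, hc.2⟩) hn
        rw [hF, Multiset.mem_toFinset]
        exact sup_mem p (by intro h; omega)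
    · rw [if_neg hc, Finset.sum_eq_zero]
      intro i hi
      rw [if_neg]
      rintro ⟨h1, rfl⟩
      exact hc ⟨h1, (Finset.mem_sdiff.1 hi).2⟩
  rw [h1, h2, h3, h4, ← Finset.sum_sdiff hS, ← Finset.sum_sdiff hS]
  have e1 : ∑ i ∈ S, ea (p.parts.count i) i = ∑ i ∈ S, (-(p.parts.count i : ℤ)
      + (if i % 2 = 1 then (p.parts.count i : ℤ) else 0) - (if i % 2 = 1 then 1 else 0)) := by
    refine Finset.sum_congr rfl fun i _ => ?_
    unfold ea
    split_ifs <;> ring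
  have e2 : ∑ i ∈ F \ S, eb p.parts.sup (p.parts.count i) i
      = ∑ i ∈ F \ S, (-(p.parts.count i : ℤ) + (if i % 2 = 1 then (p.parts.count i : ℤ) else 0)
        - (if i % 2 = 1 ∧ i = p.parts.sup then 1 else 0)) := by
    refine Finset.sum_congr rfl fun i _ => ?_
    unfold eb
    by_cases ha : i % 2 = 1 
    · rw [if_pos ha, if_pos ha]
      by_cases hb : i = p.parts.sup
      · rw [if_pos hb, if_pos ⟨ha, hb⟩]; ring
      · rw [if_neg hb, if_neg (fun h => hb h.2)]; ring
    · rw [if_neg ha, if_neg ha, if_neg (fun h => ha h.1)]; ring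
  rw [e1, e2]
  simp only [Finset.sum_add_distrib, Finset.sum_sub_distrib, Finset.sum_neg_distrib]
  ring

theorem sum_T_rank {n : ℕ} (p : n.Partition) :
    ∑ S ∈ p.parts.toFinset.powerset, (T (m2Rank (p, S)) : ℤ[T;T⁻¹])
      = T ((p.parts.sup / 2 : ℕ) : ℤ) * p.parts.toFinsupp.prod (wt p.parts.sup) := by
  have e : p.parts.toFinsupp.prod (wt p.parts.sup) = ∏ i ∈ p.parts.toFinset,
      (T (ea (p.parts.count i) i) + T (eb p.parts.sup (p.parts.count i) i)) := by
    rw [Finsupp.prod, Multiset.toFinsupp_support]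
    refine Finset.prod_congr rfl fun i hi => ?_
    rw [Multiset.toFinsupp_apply]
    have hle : i ≤ p.parts.sup := Multiset.le_sup (Multiset.mem_toFinset.1 hi)
    unfold wt wlow wtop ea eb
    rw [T_pow, mul_neg_one]
    by_cases ha : i % 2 = 1
    · rcases hle.lt_or_eq with h | h
      · simp [ha, h, h.ne, T_zero, add_comm]
      · rw [if_neg h.not_lt, if_pos h, if_pos ha, if_pos ha, if_pos ha, if_pos h, two_mul]
    · rcases hle.lt_or_eq with h | h
      · simp only [ha, h, if_true, if_false, two_mul]
      · rw [if_neg h.not_lt, if_pos h, if_neg ha, if_neg ha, if_neg ha, two_mul]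
  rw [e, Finset.prod_add, Finset.mul_sum]
  refine Finset.sum_congr rfl fun S hS => ?_
  rw [m2Rank_eq p S (Finset.mem_powerset.1 hS), T_add, T_add, T_finset_sum, T_finset_sum]

theorem prod_zero {n : ℕ} (p : n.Partition) (f : ℕ → ℕ → ℤ[T;T⁻¹]) (hp : p.parts.sup ≠ 0)
    (hf : ∀ c, f p.parts.sup c = 0) : p.parts.toFinsupp.prod f = 0 := by
  rw [Finsupp.prod, Multiset.toFinsupp_support]
  exact Finset.prod_eq_zero (Multiset.mem_toFinset.2 (sup_mem p hp)) (hf _)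

theorem coeff_DD (n s : ℕ) : PowerSeries.coeff n (DD s)
    = ∑ p : n.Partition, if p.parts.sup = s + 1 then p.parts.toFinsupp.prod (wt p.parts.sup)
      else 0 := by
  unfold DD
  rw [map_sub, Nat.Partition.coeff_genFun, Nat.Partition.coeff_genFun, ← Finset.sum_sub_distrib]
  refine Finset.sum_congr rfl fun p _ => ?_
  rcases lt_trichotomy p.parts.sup (s + 1) with h | h | h
  · rw [if_neg h.ne, sub_eq_zero]
    rw [Finsupp.prod, Finsupp.prod, Multiset.toFinsupp_support]
    refine Finset.prod_congr rfl fun i hi => ?_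
    have hle : i ≤ p.parts.sup := Multiset.le_sup (Multiset.mem_toFinset.1 hi)
    rw [wt, wtl, if_pos (by omega), if_pos (by omega)]
  · rw [if_pos h, prod_zero p (wtl (s + 1)) (by omega), sub_zero, h]
    intro c; rw [wtl, if_neg (by omega)]
  · rw [if_neg h.ne', prod_zero p (wtl (s + 1)) (by omega), prod_zero p (wt (s + 1)) (by omega),
      sub_zero]
    · intro c; rw [wt, if_neg (by omega), if_neg (by omega)]
    · intro c; rw [wtl, if_neg (by omega)]

theorem sup_le_n {n : ℕ} (p : n.Partition) : p.parts.sup ≤ n :=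
  Multiset.sup_le.2 fun _ hb => p.le_of_mem_parts hb

theorem sup_eq_zero_iff {n : ℕ} (p : n.Partition) : p.parts.sup = 0 ↔ n = 0 := by
  constructor
  · intro h
    by_contra hn
    have hne : p.parts ≠ 0 := by
      intro h0
      have := p.parts_sum
      rw [h0] at this
      exact hn (by simpa using this.symm)
    obtain ⟨a, ha⟩ := Multiset.exists_mem_of_ne_zero hne
    have h1 := p.parts_pos ha
    have h2 := Multiset.le_sup ha
    omega
  · rintro rfl
    have := sup_le_n p
    omega

theorem coeff_FS (n H : ℕ) (h : n < H) : PowerSeries.coeff n (FS H)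
    = ∑ p : n.Partition, ∑ S ∈ p.parts.toFinset.powerset, (T (m2Rank (p, S)) : ℤ[T;T⁻¹]) := by
  rw [FS_eq, map_add, map_sum]
  simp only [PowerSeries.coeff_C_mul, coeff_DD, Finset.mul_sum]
  rw [Finset.sum_comm]
  have h1 : PowerSeries.coeff n (1 : PowerSeries ℤ[T;T⁻¹])
      = ∑ p : n.Partition, if n = 0 then 1 else 0 := by
    rw [PowerSeries.coeff_one]
    by_cases hn : n = 0
    · subst hn
      simp
    · simp [hn]
  rw [h1, ← Finset.sum_add_distrib]
  refine Finset.sum_congr rfl fun p _ => ?_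
  rw [sum_T_rank]
  have hle := sup_le_n p
  by_cases hn : n = 0
  · have h0 := (sup_eq_zero_iff p).2 hn
    rw [if_pos hn, Finset.sum_eq_zero]
    · have : p.parts = 0 := by
        subst hn
        simp
      rw [h0, this]
      simp [T_zero]
    · intro s _
      rw [if_neg (by omega), mul_zero]
  · have h0 : p.parts.sup ≠ 0 := fun h => hn ((sup_eq_zero_iff p).1 h)
    obtain ⟨s, hs⟩ := Nat.exists_eq_succ_of_ne_zero h0
    rw [if_neg hn, zero_add, Finset.sum_eq_single s]
    · rw [if_pos hs, hs]
    · intro b _ hb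
      rw [if_neg (by omega), mul_zero]
    · intro hns
      exact absurd (Finset.mem_range.2 (by omega)) hns

theorem overN2_eq (m : ℤ) (n : ℕ) : (overN2 m n : ℤ)
    = (∑ p : n.Partition, ∑ S ∈ p.parts.toFinset.powerset,
        (T (m2Rank (p, S)) : ℤ[T;T⁻¹])).coeff m := by
  classical
  have hset : {p : n.Partition × Finset ℕ | p.2 ⊆ p.1.parts.toFinset ∧ m2Rank p = m}
      = ((((Finset.univ : Finset n.Partition).sigma
        (fun p => p.parts.toFinset.powerset.filter (fun S => m2Rank (p, S) = m))).image
        (fun x => (x.1, x.2)) : Finset (n.Partition × Finset ℕ)) : Set (n.Partition × Finset ℕ)) := by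
    ext ⟨p, S⟩
    simp
  unfold overN2
  rw [hset, Set.ncard_coe_finset, Finset.card_image_of_injective, Finset.card_sigma]
  · simp only [AddMonoidAlgebra.coeff_sum, Finsupp.finsetSum_apply, T_apply, Finset.card_filter]
    push_cast
    rfl
  · rintro ⟨a, b⟩ ⟨c, d⟩ h
    simp only [Prod.mk.injEq] at h
    obtain ⟨rfl, rfl⟩ := h
    rfl

end Comb

theorem overN2_antitone (m : ℤ) (hm : 0 ≤ m) (n : ℕ) : overN2 (m + 2) n ≤ overN2 m n := by
  have h := cone_coeff (KN_FS (n + 1) n (Nat.lt_succ_self n)) m hm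
  rw [coeff_FS n (n + 1) (Nat.lt_succ_self n), ← overN2_eq, ← overN2_eq] at h
  exact_mod_cast h
end
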